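/- arXiv:1704.04282 — 3 statements merged into one kernel-verified Lean document; each statement's English description precedes it below -/
import Mathlib

section
/- With K, σ_1,…,σ_d, τ_1,…,τ_d, 𝓞_K, φ and L as in the context, the subgroup L is a discrete additive subgroup of ℂ^d (i.e., L carries the discrete topology as a subspace of ℂ^d). -/
open NumberField

/-- If the real embeddings `σ` exhaust the embeddings of `K`, then every complex embedding of `K`
factors through some `σ j`. -/
lemma exists_ofReal_comp_eq {K : Type*} [Field K] [NumberField K] {d : ℕ}
    (hd : Module.finrank ℚ K = d) {σ : Fin d → (K →+* ℝ)} (hσ : Function.Injective σ)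
    (ψ : K →+* ℂ) : ∃ j, Complex.ofRealHom.comp (σ j) = ψ := by
  have hinj : Function.Injective fun j => Complex.ofRealHom.comp (σ j) := fun i j h =>
    hσ <| RingHom.ext fun x => Complex.ofReal_injective (RingHom.congr_fun h x)
  have hcard : Fintype.card (Fin d) = Fintype.card (K →+* ℂ) := by
    rw [Embeddings.card, hd, Fintype.card_fin]
  exact ((Fintype.bijective_iff_injective_and_card _).2 ⟨hinj, hcard⟩).surjective ψ

/-- In a totally real field there are finitely many integers with all conjugates bounded. -/
lemma finite_setOf_abs_le {K : Type*} [Field K] [NumberField K] {d : ℕ}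
    (hd : Module.finrank ℚ K = d) {σ : Fin d → (K →+* ℝ)} (hσ : Function.Injective σ)
    (B : Fin d → ℝ) : {x : 𝓞 K | ∀ j, |σ j (x : K)| ≤ B j}.Finite := by
  refine ((Embeddings.finite_of_norm_le K ℂ (∑ j, |B j|)).preimage
    RingOfIntegers.coe_injective.injOn).subset fun x hx => ⟨x.isIntegral_coe, fun ψ => ?_⟩
  obtain ⟨j, rfl⟩ := exists_ofReal_comp_eq hd hσ ψ
  calc ‖Complex.ofRealHom.comp (σ j) (x : K)‖ = |σ j (x : K)| := by simp
    _ ≤ |B j| := (hx j).trans (le_abs_self _)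
    _ ≤ ∑ j, |B j| :=
      Finset.single_le_sum (f := fun j => |B j|) (fun _ _ => abs_nonneg _) (Finset.mem_univ j)

/-- The coefficient of `τ` is controlled by the size of `a * τ + b`. -/
lemma abs_le_div_im_of_norm_le {a b B : ℝ} {τ : ℂ} (hτ : 0 < τ.im)
    (h : ‖(a : ℂ) * τ + b‖ ≤ B) : |a| ≤ B / τ.im := by
  rw [le_div_iff₀ hτ]
  calc |a| * τ.im = |((a : ℂ) * τ + b).im| := by simp [abs_mul, abs_of_pos hτ]
    _ ≤ B := (Complex.abs_im_le_norm _).trans h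

/-- The constant term of `a * τ + b` is controlled by the size of `a * τ + b`. -/
lemma abs_le_add_of_norm_le {a b B : ℝ} {τ : ℂ} (hτ : 0 < τ.im)
    (h : ‖(a : ℂ) * τ + b‖ ≤ B) : |b| ≤ B + B / τ.im * ‖τ‖ := by
  calc |b| = ‖((a : ℂ) * τ + b) - a * τ‖ := by simp
    _ ≤ ‖(a : ℂ) * τ + b‖ + |a| * ‖τ‖ := (norm_sub_le _ _).trans (by simp)
    _ ≤ B + B / τ.im * ‖τ‖ := by
      gcongr
      exact abs_le_div_im_of_norm_le hτ h

/-- A subset of a normed group whose bounded parts are finite is discrete. -/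
lemma discreteTopology_of_finite_norm_le {E : Type*} [NormedAddCommGroup E] {S : Set E}
    (h : ∀ B : ℝ, {x ∈ S | ‖x‖ ≤ B}.Finite) : DiscreteTopology S := by
  refine discreteTopology_iff_isOpen_singleton.2 fun x =>
    isOpen_singleton_of_finite_mem_nhds x (Metric.ball_mem_nhds x one_pos) ?_
  refine ((h (‖(x : E)‖ + 1)).preimage Subtype.val_injective.injOn).subset fun y hy =>
    ⟨y.2, ?_⟩
  have hyx : ‖(y : E) - x‖ < 1 := by simpa [Subtype.dist_eq, dist_eq_norm] using hy
  linarith [norm_le_insert' (y : E) x]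

/-- With `K`, `σ`, `τ`, `𝓞 K` and `φ` as in the context, the image
`L = φ(𝓞 K × 𝓞 K)` is a discrete additive subgroup of `ℂ^d`, i.e. it carries the discrete
topology as a subspace of `ℂ^d`. -/
theorem stmt_3 (K : Type*) [Field K] [NumberField K] (d : ℕ)
    (hd : Module.finrank ℚ K = d)
    (σ : Fin d → (K →+* ℝ)) (hσ : Function.Injective σ)
    (τ : Fin d → ℂ) (hτ : ∀ j, 0 < (τ j).im) :
    let φ : 𝓞 K × 𝓞 K → (Fin d → ℂ) :=
      fun p j => ((σ j (p.1 : K) : ℝ) : ℂ) * τ j + ((σ j (p.2 : K) : ℝ) : ℂ)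
    DiscreteTopology (Set.range φ) := by
  intro φ
  refine discreteTopology_of_finite_norm_le fun B => ?_
  refine (((finite_setOf_abs_le hd hσ fun j => B / (τ j).im).prod
    (finite_setOf_abs_le hd hσ fun j => B + B / (τ j).im * ‖τ j‖)).image φ).subset ?_
  rintro _ ⟨⟨p, rfl⟩, hp⟩
  have hj (j : Fin d) : ‖φ p j‖ ≤ B := (norm_le_pi_norm (φ p) j).trans hp
  exact ⟨p, ⟨fun j => abs_le_div_im_of_norm_le (hτ j) (hj j),
    fun j => abs_le_add_of_norm_le (hτ j) (hj j)⟩, rfl⟩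
end

section
/- With K, σ_1,…,σ_d, τ_1,…,τ_d, 𝓞_K, φ and L as in the context, L spans ℂ^d as a real vector space: the ℝ-linear span of L equals all of ℂ^d (viewed as a 2d-dimensional real vector space). Together with its discreteness, this makes L a full ℤ-lattice in ℂ^d. -/
open NumberField

/-- Distinct embeddings of a number field into `ℝ` are `ℝ`-linearly independent already as functions
on the ring of integers. -/
theorem linearIndependent_embeddings_ringOfIntegers {K ι : Type*} [Field K] [NumberField K]
    {σ : ι → (K →+* ℝ)} (hσ : Function.Injective σ) :
    LinearIndependent ℝ (fun j (x : 𝓞 K) => σ j (x : K)) := by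
  refine (linearIndependent_monoidHom (𝓞 K) ℝ).comp
    (fun j => (((σ j).comp (algebraMap (𝓞 K) K) : 𝓞 K →+* ℝ) : 𝓞 K →* ℝ)) fun i j hij => hσ ?_
  refine IsLocalization.ringHom_ext (nonZeroDivisors (𝓞 K)) (RingHom.ext fun x => ?_)
  exact DFunLike.congr_fun hij x

/-- A real-linear functional on `ι → ℂ` that kills all vectors `(σ_j(x) w_j)_j` with `x` integral
kills each coordinate vector `w_j e_j`. -/
theorem map_single_eq_zero_of_embeddings {K ι : Type*} [Field K] [NumberField K] [Fintype ι]
    [DecidableEq ι] {σ : ι → (K →+* ℝ)} (hσ : Function.Injective σ) (w : ι → ℂ)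
    (f : (ι → ℂ) →ₗ[ℝ] ℝ) (hf : ∀ x : 𝓞 K, f (fun j => ((σ j (x : K) : ℝ) : ℂ) * w j) = 0)
    (j : ι) : f (Pi.single j (w j)) = 0 := by
  refine Fintype.linearIndependent_iff.mp (linearIndependent_embeddings_ringOfIntegers hσ)
    (fun i => f (Pi.single i (w i))) (funext fun x => ?_) j
  rw [Pi.zero_apply, ← hf x,
    ← Finset.univ_sum_single (fun j => ((σ j (x : K) : ℝ) : ℂ) * w j), map_sum, Finset.sum_apply]
  refine Finset.sum_congr rfl fun i _ => ?_
  rw [← Complex.real_smul, Pi.single_smul, map_smul, Pi.smul_apply, smul_eq_mul, smul_eq_mul,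
    mul_comm]

/-- If `τ` is not real, then every complex number is a real combination of `τ` and `1`. -/
theorem Complex.exists_eq_smul_add_smul_one {τ : ℂ} (hτ : τ.im ≠ 0) (z : ℂ) :
    ∃ a b : ℝ, z = a • τ + b • (1 : ℂ) := by
  refine ⟨z.im / τ.im, z.re - z.im / τ.im * τ.re, ?_⟩
  apply Complex.ext <;> simp [hτ]

/-- With `K`, `σ`, `τ`, `𝓞 K` and `φ` as in the context, the image
`L = φ(𝓞 K × 𝓞 K)` spans `ℂ^d` as a real vector space: its `ℝ`-linear span is all of `ℂ^d`
(viewed as a `2d`-dimensional real vector space). -/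
theorem stmt_4 (K : Type*) [Field K] [NumberField K] (d : ℕ)
    (hd : Module.finrank ℚ K = d)
    (σ : Fin d → (K →+* ℝ)) (hσ : Function.Injective σ)
    (τ : Fin d → ℂ) (hτ : ∀ j, 0 < (τ j).im) :
    let φ : 𝓞 K × 𝓞 K → (Fin d → ℂ) :=
      fun p j => ((σ j (p.1 : K) : ℝ) : ℂ) * τ j + ((σ j (p.2 : K) : ℝ) : ℂ)
    Submodule.span ℝ (Set.range φ) = (⊤ : Submodule ℝ (Fin d → ℂ)) := by
  intro φ
  by_contra h
  obtain ⟨f, hf, hle⟩ := Submodule.exists_le_ker_of_lt_top _ (lt_top_iff_ne_top.mpr h)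
  have hφ (p : 𝓞 K × 𝓞 K) : f (φ p) = 0 := hle (Submodule.subset_span ⟨p, rfl⟩)
  have hτ_zero := map_single_eq_zero_of_embeddings hσ τ f fun x => by simpa [φ] using hφ (x, 0)
  have h_one_zero := map_single_eq_zero_of_embeddings hσ 1 f fun x => by simpa [φ] using hφ (0, x)
  refine hf (LinearMap.pi_ext fun j z => ?_)
  obtain ⟨a, b, rfl⟩ := Complex.exists_eq_smul_add_smul_one (hτ j).ne' z
  have h_one := h_one_zero j
  rw [Pi.one_apply] at h_one
  rw [Pi.single_add, Pi.single_smul, Pi.single_smul, map_add, map_smul, map_smul, hτ_zero j,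
    h_one, smul_zero, smul_zero, add_zero, LinearMap.zero_apply]
end

section
/- With K, σ_1,…,σ_d, τ_1,…,τ_d, 𝓞_K, φ and L as in the context, the quotient topological additive group ℂ^d / L is compact (so X := ℂ^d / L is a complex torus of complex dimension d). -/
open NumberField

/-- Distinct real embeddings are linearly independent over `ℝ` on any `ℤ`-basis of `𝓞 K`,
so the matrix of conjugates of such a basis is invertible when there are `[K : ℚ]` of them. -/
theorem isUnit_realEmbeddings_matrix {K : Type*} [Field K] [NumberField K] {d : ℕ}
    (b : Module.Basis (Fin d) ℤ (𝓞 K)) (σ : Fin d → (K →+* ℝ)) (hσ : Function.Injective σ) :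
    IsUnit (Matrix.of fun j i => σ j (b i : K) : Matrix (Fin d) (Fin d) ℝ) := by
  rw [← Matrix.linearIndependent_rows_iff_isUnit, Fintype.linearIndependent_iff]
  intro c hc
  have hlin : LinearIndependent ℝ (fun j => ((σ j : K →* ℝ) : K → ℝ)) :=
    (linearIndependent_monoidHom K ℝ).comp (fun j => (σ j : K →* ℝ)) fun j k h =>
      hσ (RingHom.ext fun x => DFunLike.congr_fun h x)
  have hb : ∀ i, ∑ j, c j * σ j (b i : K) = 0 := fun i => by
    simpa [Matrix.row, Finset.sum_apply] using congrFun hc i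
  let f : K →+ ℝ := ∑ j, (AddMonoidHom.mulLeft (c j)).comp (σ j).toAddMonoidHom
  have hf : f.toRatLinearMap = 0 :=
    (b.localizationLocalization ℚ (nonZeroDivisors ℤ) K).ext fun i => by
      simpa [f, AddMonoidHom.finsetSum_apply] using hb i
  refine Fintype.linearIndependent_iff.1 hlin c (funext fun x => ?_)
  simpa [f, AddMonoidHom.finsetSum_apply] using LinearMap.congr_fun hf x

/-- A quotient of a topological additive group is compact as soon as there is a continuous
surjection from `ι → ℝ` sending integral translates to translates by the subgroup. -/
theorem compactSpace_quotient_of_integral_translates {ι V : Type*} [AddCommGroup V]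
    [TopologicalSpace V] (L : AddSubgroup V) (F : (ι → ℝ) → V) (hF : Continuous F)
    (hsurj : Function.Surjective F)
    (htrans : ∀ (r : ι → ℝ) (n : ι → ℤ), F (fun i => r i + n i) - F r ∈ L) :
    CompactSpace (V ⧸ L) := by
  have hK : IsCompact (Set.univ.pi fun _ : ι => Set.Icc (0 : ℝ) 1) :=
    isCompact_univ_pi fun _ => isCompact_Icc
  refine ⟨(hK.image (f := fun r => (F r : V ⧸ L))
    (continuous_quotient_mk'.comp hF)).of_isClosed_subset isClosed_univ fun q _ => ?_⟩
  obtain ⟨v, rfl⟩ := QuotientAddGroup.mk_surjective q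
  obtain ⟨r, rfl⟩ := hsurj v
  refine ⟨fun i => Int.fract (r i),
    fun i _ => ⟨Int.fract_nonneg _, (Int.fract_lt_one _).le⟩, QuotientAddGroup.eq.2 ?_⟩
  have h := htrans (fun i => Int.fract (r i)) fun i => ⌊r i⌋
  simpa only [Int.fract_add_floor, sub_eq_neg_add] using h

/-- With `K`, `σ`, `τ`, `𝓞 K`, `φ` and `L = φ(𝓞 K × 𝓞 K)` as in the context,
the quotient topological additive group `ℂ^d / L` is compact. -/
theorem stmt_6 (K : Type*) [Field K] [NumberField K] (d : ℕ)
    (hd : Module.finrank ℚ K = d)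
    (σ : Fin d → (K →+* ℝ)) (hσ : Function.Injective σ)
    (τ : Fin d → ℂ) (hτ : ∀ j, 0 < (τ j).im) :
    let φ : 𝓞 K × 𝓞 K →+ (Fin d → ℂ) :=
      AddMonoidHom.mk'
        (fun p j => ((σ j (p.1 : K) : ℝ) : ℂ) * τ j + ((σ j (p.2 : K) : ℝ) : ℂ))
        (by
          intro p q
          funext j
          simp only [Prod.fst_add, Prod.snd_add, map_add, Complex.ofReal_add, Pi.add_apply]
          ring)
    CompactSpace ((Fin d → ℂ) ⧸ φ.range) := by
  intro φ
  have hcard : Fintype.card (Module.Free.ChooseBasisIndex ℤ (𝓞 K)) = d := by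
    rw [← Module.finrank_eq_card_chooseBasisIndex, RingOfIntegers.rank, hd]
  let b : Module.Basis (Fin d) ℤ (𝓞 K) :=
    (RingOfIntegers.basis K).reindex (Fintype.equivFinOfCardEq hcard)
  let M : Matrix (Fin d) (Fin d) ℝ := Matrix.of fun j i => σ j (b i : K)
  have hM : Function.Surjective M.mulVec :=
    Matrix.mulVec_surjective_iff_isUnit.2 (isUnit_realEmbeddings_matrix b σ hσ)
  have hMint : ∀ (n : Fin d → ℤ) (j : Fin d),
      M.mulVec (fun i => (n i : ℝ)) j = σ j ((∑ i, n i • b i : 𝓞 K) : K) := fun n j => by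
    simp [M, Matrix.mulVec, dotProduct, mul_comm]
  refine compactSpace_quotient_of_integral_translates (ι := Fin d ⊕ Fin d) φ.range
    (fun r j => ((M.mulVec (r ∘ Sum.inl) j : ℝ) : ℂ) * τ j + ((M.mulVec (r ∘ Sum.inr) j : ℝ) : ℂ))
    ?_ ?_ ?_
  · unfold Matrix.mulVec dotProduct
    fun_prop
  · intro z
    obtain ⟨r, hr⟩ := hM fun j => (z j).im / (τ j).im
    obtain ⟨s, hs⟩ := hM fun j => (z j).re - (z j).im / (τ j).im * (τ j).re
    refine ⟨Sum.elim r s, funext fun j => ?_⟩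
    have := (hτ j).ne'
    apply Complex.ext <;> simp [hr, hs, this]
  · intro r n
    refine ⟨(∑ i, n (.inl i) • b i, ∑ i, n (.inr i) • b i), funext fun j => ?_⟩
    have hadd : ∀ f : Fin d → Fin d ⊕ Fin d,
        M.mulVec ((fun i => r i + (n i : ℝ)) ∘ f) =
          M.mulVec (r ∘ f) + M.mulVec (fun i => (n (f i) : ℝ)) := fun f => by
      rw [← Matrix.mulVec_add]; rfl
    simp only [φ, AddMonoidHom.mk'_apply, Pi.sub_apply, hadd, Pi.add_apply, ← hMint,
      Complex.ofReal_add]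
    ring
end
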